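/- arXiv:2405.12001 — 2 statements merged into one kernel-verified Lean document; each statement's English description precedes it below -/
import Mathlib

section
/- Let π₁ and π₂ be two L_z-Lipschitz policy families and let Z₁, Z₂, Z_mut : I → E be assignments of task representations. Define ε = J(π₂, Z_mut) − J(π₁, Z_mut). Then J(π₂, Z₂) − J(π₁, Z₁) ≥ ε − (2 R_max L_z / (1−γ)²) · ∑_{i∈I} w_i · ( 2·dist(Z₂(i), Z_mut(i)) + dist(Z₂(i), Z₁(i)) ). (Lower bound of performance difference in COMRL: the performance change between two consecutive updates is lower-bounded by the improvement under the reference representation Z_mut minus terms controlled by the task representation shift dist(Z₂(i), Z₁(i)) and the deviation of Z₂ from Z_mut.) -/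
open scoped BigOperators

/-- Total variation distance between two PMFs on a finite type. -/
noncomputable def DTV {α : Type*} [Fintype α] (p q : PMF α) : ℝ :=
  (1 / 2) * ∑ x, |(p x).toReal - (q x).toReal|

/-- The time-`t` state–action distribution of policy `π` in the MDP with transition
kernel `P` and initial state distribution `ρ₀`. -/
noncomputable def stateActionDist {S A : Type*} (π : S → PMF A) (P : S × A → PMF S)
    (ρ₀ : PMF S) : ℕ → PMF (S × A)
  | 0 => ρ₀.bind fun s => (π s).map fun a => (s, a)
  | (t + 1) => (stateActionDist π P ρ₀ t).bind fun sa =>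
      (P sa).bind fun s' => (π s').map fun a' => (s', a')

/-- The expected discounted return of policy `π` under transition kernel `P`,
initial distribution `ρ₀`, discount `γ` and reward `R`. -/
noncomputable def Vret {S A : Type*} [Fintype S] [Fintype A] (π : S → PMF A)
    (P : S × A → PMF S) (ρ₀ : PMF S) (γ : ℝ) (R : S × A → ℝ) : ℝ :=
  ∑' t : ℕ, γ ^ t * ∑ sa : S × A, ((stateActionDist π P ρ₀ t) sa).toReal * R sa

/-- The task-averaged expected return of policy family `π` conditioned on the
task representation assignment `ζ`. -/
noncomputable def Jret {S A E I : Type*} [Fintype S] [Fintype A] [Fintype I]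
    (π : S → E → PMF A) (ζ : I → E) (P : I → S × A → PMF S) (R : I → S × A → ℝ)
    (ρ₀ : PMF S) (γ : ℝ) (w : I → ℝ) : ℝ :=
  ∑ i, w i * Vret (fun s => π s (ζ i)) (P i) ρ₀ γ (R i)

theorem PMF.toReal_bind_apply {α β : Type*} [Fintype α] (p : PMF α) (f : α → PMF β) (b : β) :
    ((p.bind f) b).toReal = ∑ a, (p a).toReal * (f a b).toReal := by
  rw [PMF.bind_apply, tsum_fintype, ENNReal.toReal_sum]
  · simp only [ENNReal.toReal_mul]
  · exact fun a _ => ENNReal.mul_ne_top (p.apply_ne_top a) ((f a).apply_ne_top b)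

theorem PMF.sum_toReal {α : Type*} [Fintype α] (p : PMF α) : ∑ a, (p a).toReal = 1 := by
  rw [← ENNReal.toReal_sum fun a _ => p.apply_ne_top a, ← tsum_fintype (L := .unconditional _),
    p.tsum_coe, ENNReal.toReal_one]

theorem DTV_self {α : Type*} [Fintype α] (p : PMF α) : DTV p p = 0 := by
  simp [DTV]

theorem DTV_bind_le {α β : Type*} [Fintype α] [Fintype β] (p q : PMF α) (f g : α → PMF β)
    {K : ℝ} (hK : ∀ a, DTV (f a) (g a) ≤ K) :
    DTV (p.bind f) (q.bind g) ≤ DTV p q + K := by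
  have hpt : ∀ b, |((p.bind f) b).toReal - ((q.bind g) b).toReal| ≤
      ∑ a, (|(p a).toReal - (q a).toReal| * (f a b).toReal +
        (q a).toReal * |(f a b).toReal - (g a b).toReal|) := by
    intro b
    rw [PMF.toReal_bind_apply, PMF.toReal_bind_apply, ← Finset.sum_sub_distrib]
    refine (Finset.abs_sum_le_sum_abs _ _).trans (Finset.sum_le_sum fun a _ => ?_)
    calc |(p a).toReal * (f a b).toReal - (q a).toReal * (g a b).toReal|
        = |((p a).toReal - (q a).toReal) * (f a b).toReal +
            (q a).toReal * ((f a b).toReal - (g a b).toReal)| := by ring_nf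
      _ ≤ _ := (abs_add_le _ _).trans_eq (by
          rw [abs_mul, abs_mul, abs_of_nonneg (a := (f a b).toReal) ENNReal.toReal_nonneg,
            abs_of_nonneg (a := (q a).toReal) ENNReal.toReal_nonneg])
  calc DTV (p.bind f) (q.bind g)
      ≤ (1 / 2) * ∑ b, ∑ a, (|(p a).toReal - (q a).toReal| * (f a b).toReal +
        (q a).toReal * |(f a b).toReal - (g a b).toReal|) :=
        mul_le_mul_of_nonneg_left (Finset.sum_le_sum fun b _ => hpt b) (by norm_num)
    _ = DTV p q + ∑ a, (q a).toReal * DTV (f a) (g a) := by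
        rw [Finset.sum_comm]
        simp only [Finset.sum_add_distrib, ← Finset.mul_sum, PMF.sum_toReal, mul_one, mul_add, DTV]
        congr 1
        rw [Finset.mul_sum]
        exact Finset.sum_congr rfl fun a _ => by ring
    _ ≤ DTV p q + ∑ a, (q a).toReal * K := by
        gcongr with a
        exact hK a
    _ = DTV p q + K := by rw [← Finset.sum_mul, PMF.sum_toReal, one_mul]

theorem DTV_map_le {α β : Type*} [Fintype α] [Fintype β] (p q : PMF α) (f : α → β) :
    DTV (p.map f) (q.map f) ≤ DTV p q :=
  (DTV_bind_le p q (PMF.pure ∘ f) (PMF.pure ∘ f) fun _ => (DTV_self _).le).trans_eq (add_zero _)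

theorem DTV_stateActionDist_le {S A : Type*} [Fintype S] [Fintype A] (π π' : S → PMF A)
    (P : S × A → PMF S) (ρ₀ : PMF S) {δ : ℝ} (hδ : ∀ s, DTV (π s) (π' s) ≤ δ) (t : ℕ) :
    DTV (stateActionDist π P ρ₀ t) (stateActionDist π' P ρ₀ t) ≤ (t + 1) * δ := by
  have step : ∀ ρ : PMF S, DTV (ρ.bind fun s => (π s).map fun a => (s, a))
      (ρ.bind fun s => (π' s).map fun a => (s, a)) ≤ δ := fun ρ =>
    (DTV_bind_le ρ ρ _ _ fun s => (DTV_map_le _ _ _).trans (hδ s)).trans_eq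
      (by rw [DTV_self, zero_add])
  induction t with
  | zero => simpa [stateActionDist] using step ρ₀
  | succ t ih =>
    refine (DTV_bind_le _ _ _ _ fun sa => step (P sa)).trans ?_
    push_cast
    linarith

theorem abs_sum_toReal_mul_le {α : Type*} [Fintype α] (p : PMF α) {R : α → ℝ} {M : ℝ}
    (hR : ∀ a, |R a| ≤ M) : |∑ a, (p a).toReal * R a| ≤ M := by
  calc |∑ a, (p a).toReal * R a| ≤ ∑ a, (p a).toReal * M := by
        refine (Finset.abs_sum_le_sum_abs _ _).trans (Finset.sum_le_sum fun a _ => ?_)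
        rw [abs_mul, abs_of_nonneg (a := (p a).toReal) ENNReal.toReal_nonneg]
        exact mul_le_mul_of_nonneg_left (hR a) ENNReal.toReal_nonneg
    _ = M := by rw [← Finset.sum_mul, PMF.sum_toReal, one_mul]

theorem abs_sum_toReal_mul_sub_le {α : Type*} [Fintype α] (p q : PMF α) {R : α → ℝ} {M : ℝ}
    (hR : ∀ a, |R a| ≤ M) :
    |∑ a, (p a).toReal * R a - ∑ a, (q a).toReal * R a| ≤ 2 * M * DTV p q := by
  calc |∑ a, (p a).toReal * R a - ∑ a, (q a).toReal * R a|
      ≤ ∑ a, |(p a).toReal - (q a).toReal| * M := by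
        rw [← Finset.sum_sub_distrib]
        refine (Finset.abs_sum_le_sum_abs _ _).trans (Finset.sum_le_sum fun a _ => ?_)
        rw [← sub_mul, abs_mul]
        exact mul_le_mul_of_nonneg_left (hR a) (abs_nonneg _)
    _ = 2 * M * DTV p q := by
        rw [← Finset.sum_mul, DTV]
        ring

theorem summable_discounted_reward {S A : Type*} [Fintype S] [Fintype A] (π : S → PMF A)
    (P : S × A → PMF S) (ρ₀ : PMF S) {γ : ℝ} (hγ0 : 0 ≤ γ) (hγ1 : γ < 1) {R : S × A → ℝ} {M : ℝ}
    (hR : ∀ sa, |R sa| ≤ M) :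
    Summable fun t : ℕ => γ ^ t * ∑ sa : S × A, ((stateActionDist π P ρ₀ t) sa).toReal * R sa := by
  refine .of_norm_bounded ((summable_geometric_of_lt_one hγ0 hγ1).mul_right M) fun t => ?_
  rw [Real.norm_eq_abs, abs_mul, abs_of_nonneg (pow_nonneg hγ0 t)]
  exact mul_le_mul_of_nonneg_left (abs_sum_toReal_mul_le _ hR) (pow_nonneg hγ0 t)

/-- The return is Lipschitz in the policy, with respect to the uniform total variation distance. -/
theorem abs_Vret_sub_le {S A : Type*} [Fintype S] [Fintype A] (π π' : S → PMF A)
    (P : S × A → PMF S) (ρ₀ : PMF S) {γ : ℝ} (hγ0 : 0 ≤ γ) (hγ1 : γ < 1) {R : S × A → ℝ} {M : ℝ}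
    (hM : 0 ≤ M) (hR : ∀ sa, |R sa| ≤ M) {δ : ℝ} (hδ : ∀ s, DTV (π s) (π' s) ≤ δ) :
    |Vret π P ρ₀ γ R - Vret π' P ρ₀ γ R| ≤ 2 * M * δ / (1 - γ) ^ 2 := by
  have hsum : HasSum (fun t : ℕ => ((t : ℝ) + 1) * γ ^ t * (2 * M * δ))
      (2 * M * δ / (1 - γ) ^ 2) := by
    have h := (hasSum_choose_mul_geometric_of_norm_lt_one 1
      (show ‖γ‖ < 1 by rwa [Real.norm_eq_abs, abs_of_nonneg hγ0])).mul_right (2 * M * δ)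
    simp only [Nat.choose_one_right, Nat.cast_add, Nat.cast_one, one_add_one_eq_two] at h
    rwa [one_div_mul_eq_div] at h
  rw [Vret, Vret, ← (summable_discounted_reward π P ρ₀ hγ0 hγ1 hR).tsum_sub
    (summable_discounted_reward π' P ρ₀ hγ0 hγ1 hR), ← Real.norm_eq_abs]
  refine tsum_of_norm_bounded hsum fun t => ?_
  rw [← mul_sub, Real.norm_eq_abs, abs_mul, abs_of_nonneg (pow_nonneg hγ0 t)]
  calc _ ≤ γ ^ t * (2 * M * ((t + 1) * δ)) := by
        refine mul_le_mul_of_nonneg_left ?_ (pow_nonneg hγ0 t)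
        exact (abs_sum_toReal_mul_sub_le _ _ hR).trans (mul_le_mul_of_nonneg_left
          (DTV_stateActionDist_le π π' P ρ₀ hδ t) (by positivity))
    _ = _ := by ring

/-- **Lower bound of performance difference in COMRL** (Theorem 3). -/
theorem performance_difference_lower_bound_COMRL
    {S A : Type*} [Fintype S] [Nonempty S] [Fintype A] [Nonempty A]
    {E : Type*} [MetricSpace E] {I : Type*} [Fintype I]
    (ρ₀ : PMF S) (γ : ℝ) (hγ0 : 0 ≤ γ) (hγ1 : γ < 1)
    (w : I → ℝ) (hw0 : ∀ i, 0 ≤ w i) (hw1 : ∑ i, w i = 1)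
    (P : I → S × A → PMF S) (R : I → S × A → ℝ)
    (Rmax : ℝ) (hRmax : 0 ≤ Rmax) (hR : ∀ i sa, |R i sa| ≤ Rmax)
    (Lz : ℝ) (hLz : 0 ≤ Lz)
    (π₁ π₂ : S → E → PMF A)
    (hLip1 : ∀ s z z', DTV (π₁ s z) (π₁ s z') ≤ Lz * dist z z')
    (hLip2 : ∀ s z z', DTV (π₂ s z) (π₂ s z') ≤ Lz * dist z z')
    (Z₁ Z₂ Zmut : I → E) :
    Jret π₂ Z₂ P R ρ₀ γ w - Jret π₁ Z₁ P R ρ₀ γ w ≥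
      (Jret π₂ Zmut P R ρ₀ γ w - Jret π₁ Zmut P R ρ₀ γ w) -
        2 * Rmax * Lz / (1 - γ) ^ 2 *
          ∑ i, w i * (2 * dist (Z₂ i) (Zmut i) + dist (Z₂ i) (Z₁ i)) := by
  have hV : ∀ π : S → E → PMF A, (∀ s z z', DTV (π s z) (π s z') ≤ Lz * dist z z') →
      ∀ i z z', Vret (fun s => π s z) (P i) ρ₀ γ (R i) - Vret (fun s => π s z') (P i) ρ₀ γ (R i) ≤
        2 * Rmax * Lz / (1 - γ) ^ 2 * dist z z' := fun π hπ i z z' =>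
    (le_abs_self _).trans <| (abs_Vret_sub_le _ _ (P i) ρ₀ hγ0 hγ1 hRmax (hR i)
      fun s => hπ s z z').trans_eq (by ring)
  have hC : 0 ≤ 2 * Rmax * Lz / (1 - γ) ^ 2 := by positivity
  rw [ge_iff_le, sub_le_iff_le_add, ← sub_le_iff_le_add', Finset.mul_sum]
  simp only [Jret]
  rw [← Finset.sum_sub_distrib, ← Finset.sum_sub_distrib, ← Finset.sum_sub_distrib]
  refine Finset.sum_le_sum fun i _ => ?_
  have h₂ := hV π₂ hLip2 i (Zmut i) (Z₂ i)
  have h₁ := hV π₁ hLip1 i (Z₁ i) (Zmut i)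
  have ht : dist (Z₁ i) (Zmut i) ≤ dist (Z₂ i) (Z₁ i) + dist (Z₂ i) (Zmut i) :=
    dist_triangle_left _ _ _
  have hd := mul_le_mul_of_nonneg_left ht hC
  rw [dist_comm] at h₂
  rw [mul_left_comm, ← mul_sub, ← mul_sub, ← mul_sub]
  refine mul_le_mul_of_nonneg_left ?_ (hw0 i)
  linarith
end

section
/- Fix R_max > 0, γ ∈ [0,1), L_z > 0, β ≥ 0 and set κ = 2 R_max / (1−γ)². Let 𝒜 be a finite set with |𝒜| = a ≥ 2, let P be a probability mass function on 𝒜, let ξ ∈ (0,1], and let ε be a real number with ε > κ L_z β. If the total number of independent samples m = N + k satisfies m ≥ (8 κ² L_z² / (ε − κ L_z β)²) · log((2^a − 2)/ξ), then with probability at least 1 − ξ the empirical distribution P̂ of the m samples satisfies ‖P̂ − P‖₁ ≤ (ε − κ L_z β) / (2 κ L_z) = ε/(2 κ L_z) − β/2; that is, the condition guaranteeing monotonic performance improvement holds with probability at least 1 − ξ. (Monotonic performance improvement guarantee on empirical distribution: k = (8 κ² L_z² / (ε − κ L_z β)²) · log((2^a − 2)/ξ) − N extra i.i.d. samples suffice.)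 -/
open scoped BigOperators Classical
open MeasureTheory

/-- The empirical distribution of the samples `x : Fin m → 𝒜`. -/
noncomputable def empDist {𝒜 : Type*} [Fintype 𝒜] {m : ℕ} (x : Fin m → 𝒜) (j : 𝒜) : ℝ :=
  (∑ i, if x i = j then (1 : ℝ) else 0) / m

lemma sum_empDist {𝒜 : Type*} [Fintype 𝒜] {m : ℕ} (x : Fin m → 𝒜) (A : Finset 𝒜) :
    ∑ j ∈ A, empDist x j = (∑ i, if x i ∈ A then (1 : ℝ) else 0) / m := by
  simp only [empDist]
  rw [← Finset.sum_div, Finset.sum_comm]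
  simp

lemma PMF.sum_toReal_eq_one {α : Type*} [Fintype α] (p : PMF α) :
    ∑ j, (p j).toReal = 1 := by
  rw [← ENNReal.toReal_sum fun j _ => p.apply_ne_top j, ← tsum_fintype (L := .unconditional _),
    p.tsum_coe, ENNReal.toReal_one]

/-- A function of zero total mass with `L1` norm above `t` puts mass above `t / 2` on some
nontrivial event. -/
lemma exists_finset_half_lt_sum {α : Type*} [Fintype α] {v : α → ℝ} (hv : ∑ j, v j = 0)
    {t : ℝ} (ht : 0 ≤ t) (h : t < ∑ j, |v j|) :
    ∃ A : Finset α, A ≠ ∅ ∧ A ≠ Finset.univ ∧ t / 2 < ∑ j ∈ A, v j := by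
  have hsum : ∑ j, |v j| = 2 * ∑ j ∈ Finset.univ.filter (fun j => 0 < v j), v j := by
    have habs : ∀ j, |v j| = 2 * (if 0 < v j then v j else 0) - v j := by
      intro j
      split_ifs with hj
      · rw [abs_of_pos hj]; ring
      · rw [abs_of_nonpos (not_lt.mp hj)]; ring
    rw [Finset.sum_congr rfl fun j _ => habs j, Finset.sum_sub_distrib, hv, sub_zero,
      ← Finset.mul_sum, Finset.sum_filter]
  refine ⟨Finset.univ.filter (fun j => 0 < v j), ?_, ?_, by linarith⟩
  · intro hA
    rw [hsum, hA, Finset.sum_empty] at h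
    linarith
  · intro hA
    rw [hsum, hA, hv] at h
    linarith

/-- Hoeffding's inequality for the empirical frequency of an event. -/
lemma measureReal_empirical_frequency_ge_le {𝒜 : Type*} [Fintype 𝒜] [MeasurableSpace 𝒜]
    [MeasurableSingletonClass 𝒜] (P : PMF 𝒜) {m : ℕ} (hm : 0 < m) (A : Finset 𝒜) {s : ℝ}
    (hs : 0 ≤ s) :
    (Measure.pi fun _ : Fin m => P.toMeasure).real
      {x | s ≤ ∑ j ∈ A, (empDist x j - (P j).toReal)} ≤ Real.exp (-(2 * m * s ^ 2)) := by
  set μ := Measure.pi fun _ : Fin m => P.toMeasure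
  let f : 𝒜 → ℝ := fun y => if y ∈ A then 1 else 0
  have hf : Measurable f := measurable_of_finite f
  have hint : ∫ y, f y ∂P.toMeasure = ∑ j ∈ A, (P j).toReal := by
    simp [PMF.integral_eq_sum, f]
  have hindep : ProbabilityTheory.iIndepFun
      (fun (i : Fin m) x => f (x i) - ∫ y, f y ∂P.toMeasure) μ :=
    ProbabilityTheory.iIndepFun_pi (X := fun _ y => f y - ∫ y, f y ∂P.toMeasure)
      fun _ => (hf.sub_const _).aemeasurable
  have hsub : ∀ i ∈ (Finset.univ : Finset (Fin m)), ProbabilityTheory.HasSubgaussianMGF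
      (fun x : Fin m → 𝒜 => f (x i) - ∫ y, f y ∂P.toMeasure)
      ((‖(1 : ℝ) - 0‖₊ / 2) ^ 2) μ := by
    intro i _
    have hmp : MeasurePreserving (fun x : Fin m → 𝒜 => x i) μ P.toMeasure :=
      measurePreserving_eval _ i
    have hmean : ∫ y, f y ∂P.toMeasure = ∫ x, f (x i) ∂μ := by
      rw [← hmp.map_eq, integral_map hmp.aemeasurable hf.aestronglyMeasurable]
    rw [hmean]
    refine ProbabilityTheory.hasSubgaussianMGF_of_mem_Icc
      (hf.comp hmp.measurable).aemeasurable (Filter.Eventually.of_forall fun x => ?_)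
    simp only [f]
    split_ifs <;> simp
  have hm' : (0 : ℝ) < m := by exact_mod_cast hm
  have key := ProbabilityTheory.HasSubgaussianMGF.measure_sum_ge_le_of_iIndepFun hindep hsub
    (mul_nonneg hm'.le hs)
  convert key using 2
  · congr 1
    ext x
    rw [Finset.sum_sub_distrib, Finset.sum_sub_distrib, sum_empDist, hint]
    simp only [f, Finset.sum_const, Finset.card_univ, Fintype.card_fin, nsmul_eq_mul]
    rw [div_sub' hm'.ne', le_div_iff₀ hm', mul_comm s]
  · simp
    field_simp

/-- Concentration of the empirical distribution in `L1` distance. -/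
lemma measureReal_lt_l1_deviation_le {𝒜 : Type*} [Fintype 𝒜] [MeasurableSpace 𝒜]
    [MeasurableSingletonClass 𝒜] [Nonempty 𝒜] (P : PMF 𝒜) {m : ℕ} (hm : 0 < m) {t : ℝ}
    (ht : 0 ≤ t) :
    (Measure.pi fun _ : Fin m => P.toMeasure).real
      {x | t < ∑ j, |empDist x j - (P j).toReal|} ≤
        ((2 : ℝ) ^ Fintype.card 𝒜 - 2) * Real.exp (-(m * t ^ 2 / 2)) := by
  let S : Finset (Finset 𝒜) := Finset.univ \ {∅, Finset.univ}
  have hcard : (S.card : ℝ) = (2 : ℝ) ^ Fintype.card 𝒜 - 2 := by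
    have hpair : ({∅, Finset.univ} : Finset (Finset 𝒜)).card = 2 :=
      Finset.card_pair Finset.univ_nonempty.ne_empty.symm
    rw [Finset.cast_card_sdiff (Finset.subset_univ _), hpair]
    simp
  have hzero : ∀ x : Fin m → 𝒜, ∑ j, (empDist x j - (P j).toReal) = 0 := by
    intro x
    have hm' : (m : ℝ) ≠ 0 := by exact_mod_cast hm.ne'
    rw [Finset.sum_sub_distrib, P.sum_toReal_eq_one, sum_empDist]
    simp [hm']
  calc _ ≤ (Measure.pi fun _ : Fin m => P.toMeasure).real
        (⋃ A ∈ S, {x | t / 2 ≤ ∑ j ∈ A, (empDist x j - (P j).toReal)}) := by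
        refine measureReal_mono (fun x hx => ?_) (measure_ne_top _ _)
        obtain ⟨A, hA, hA', hlt⟩ := exists_finset_half_lt_sum (hzero x) ht hx
        exact Set.mem_biUnion (x := A) (by simp [S, hA, hA']) hlt.le
    _ ≤ ∑ A ∈ S, (Measure.pi fun _ : Fin m => P.toMeasure).real
        {x | t / 2 ≤ ∑ j ∈ A, (empDist x j - (P j).toReal)} :=
        measureReal_biUnion_finset_le _ _
    _ ≤ ∑ A ∈ S, Real.exp (-(2 * m * (t / 2) ^ 2)) :=
        Finset.sum_le_sum fun A _ => measureReal_empirical_frequency_ge_le P hm A (by positivity)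
    _ = _ := by
        rw [Finset.sum_const, nsmul_eq_mul, hcard]
        ring_nf

/-- **Monotonic performance improvement guarantee on empirical distribution**
(Corollary 1): with `κ = 2 R_max / (1−γ)²`, if the total number of i.i.d. samples
`m = N + k` satisfies `m ≥ (8 κ² L_z² / (ε − κ L_z β)²) · log((2^a − 2)/ξ)`, then with
probability at least `1 − ξ` the L1 deviation of the empirical distribution is at most
`(ε − κ L_z β)/(2 κ L_z)`, the sufficient condition for monotonic improvement. -/
theorem monotonic_improvement_empirical
    {𝒜 : Type*} [Fintype 𝒜] [MeasurableSpace 𝒜] [MeasurableSingletonClass 𝒜]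
    (a : ℕ) (ha : Fintype.card 𝒜 = a) (ha2 : 2 ≤ a) (P : PMF 𝒜)
    (ξ : ℝ) (hξ0 : 0 < ξ) (hξ1 : ξ ≤ 1)
    (Rmax γ Lz β ε : ℝ) (hRmax : 0 < Rmax) (hγ0 : 0 ≤ γ) (hγ1 : γ < 1)
    (hLz : 0 < Lz) (hβ : 0 ≤ β)
    (hε : 2 * Rmax / (1 - γ) ^ 2 * Lz * β < ε)
    (N k : ℕ)
    (hm : 8 * (2 * Rmax / (1 - γ) ^ 2) ^ 2 * Lz ^ 2 /
          (ε - 2 * Rmax / (1 - γ) ^ 2 * Lz * β) ^ 2 *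
          Real.log (((2 : ℝ) ^ a - 2) / ξ) ≤ ((N + k : ℕ) : ℝ)) :
    1 - ξ ≤ ((Measure.pi fun _ : Fin (N + k) => P.toMeasure)
        {x | ∑ j, |empDist x j - (P j).toReal| ≤
          (ε - 2 * Rmax / (1 - γ) ^ 2 * Lz * β) /
            (2 * (2 * Rmax / (1 - γ) ^ 2) * Lz)}).toReal := by
  set κ := 2 * Rmax / (1 - γ) ^ 2
  have hκ : 0 < κ := div_pos (by positivity) (pow_pos (by linarith) 2)
  have hδ : 0 < ε - κ * Lz * β := by linarith
  set t := (ε - κ * Lz * β) / (2 * κ * Lz) with ht_def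
  have ht : 0 < t := by positivity
  have hcoef : 8 * κ ^ 2 * Lz ^ 2 / (ε - κ * Lz * β) ^ 2 = 2 / t ^ 2 := by
    rw [ht_def]
    field_simp
    ring
  rw [hcoef] at hm
  have hpow : (4 : ℝ) ≤ 2 ^ a := by
    calc (4 : ℝ) = 2 ^ 2 := by norm_num
      _ ≤ 2 ^ a := pow_le_pow_right₀ (by norm_num) ha2
  have hratio : 1 < ((2 : ℝ) ^ a - 2) / ξ := by
    rw [lt_div_iff₀ hξ0]
    linarith
  have hlog := Real.log_pos hratio
  have hpos : 0 < N + k := by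
    have : (0 : ℝ) < ((N + k : ℕ) : ℝ) := lt_of_lt_of_le (by positivity) hm
    exact_mod_cast this
  have : Nonempty 𝒜 := Fintype.card_pos_iff.mp (by omega)
  have hbad := measureReal_lt_l1_deviation_le P hpos ht.le
  have hexp : ((2 : ℝ) ^ a - 2) * Real.exp (-((N + k : ℕ) * t ^ 2 / 2)) ≤ ξ := by
    have hle : Real.log (((2 : ℝ) ^ a - 2) / ξ) ≤ (N + k : ℕ) * t ^ 2 / 2 := by
      rw [div_mul_eq_mul_div, div_le_iff₀ (by positivity)] at hm
      linarith
    rw [Real.log_le_iff_le_exp (by positivity), div_le_iff₀ hξ0] at hle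
    rw [Real.exp_neg, ← div_eq_mul_inv, div_le_iff₀ (Real.exp_pos _)]
    linarith
  rw [ha] at hbad
  have hcompl : {x : Fin (N + k) → 𝒜 | ∑ j, |empDist x j - (P j).toReal| ≤ t} =
      {x | t < ∑ j, |empDist x j - (P j).toReal|}ᶜ := by
    ext x
    simp
  rw [hcompl, ← measureReal_def, probReal_compl_eq_one_sub (Set.toFinite _).measurableSet]
  linarith
end
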